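/- Let u : ℤ → ℝ be a finitely supported function. Then sup over all nonzero f ∈ ℓ²(ℤ) of ‖∇(f*u)‖₂ / ‖f‖₂ equals sup over ξ ∈ ℝ of |e^{iξ} - 1| · |∑_{k∈ℤ} u(k) e^{-ikξ}|. -/

import Mathlib

open scoped BigOperators

/-- Convolution of `f ∈ ℓ²(ℤ)` with a finitely supported kernel `u : ℤ → ℝ`:
`(f*u)(m) = ∑_{k} u(k) f(m-k)`. -/
noncomputable def conv (u : ℤ → ℝ) (f : ℤ → ℂ) : ℤ → ℂ :=
  fun m => ∑' k : ℤ, (u k : ℂ) * f (m - k)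

/-- The `ℓ²`-norm `(∑_{k∈ℤ} |f(k)|²)^{1/2}`. -/
noncomputable def l2norm (f : ℤ → ℂ) : ℝ :=
  Real.sqrt (∑' k : ℤ, ‖f k‖ ^ 2)

/-- The discrete derivative `(∇f)(k) = f(k+1) - f(k)`. -/
def dgrad (f : ℤ → ℂ) : ℤ → ℂ := fun k => f (k + 1) - f k

/-- The discrete Laplacian `(Δf)(k) = f(k+2) - 2f(k+1) + f(k)`. -/
def dlap (f : ℤ → ℂ) : ℤ → ℂ := fun k => f (k + 2) - 2 * f (k + 1) + f k

open MeasureTheory AddCircle in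
/-- Multiplying by a trigonometric polynomial convolves the Fourier coefficients. -/
theorem fourierCoeff_trigPolynomial_mul {T : ℝ} [hT : Fact (0 < T)] (S : Finset ℤ) (c : ℤ → ℂ)
    {F : AddCircle T → ℂ} (hF : Integrable F haarAddCircle) (n : ℤ) :
    fourierCoeff (fun x => (∑ k ∈ S, c k * fourier k x) * F x) n
      = ∑ k ∈ S, c k * fourierCoeff F (n - k) := by
  have hint (k : ℤ) :
      Integrable (fun t : AddCircle T => c k * (fourier (-(n - k)) t • F t)) haarAddCircle :=
    (hF.fourier_smul (-(n - k))).const_mul _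
  simp only [fourierCoeff]
  calc
    _ = ∫ t, ∑ k ∈ S, c k * (fourier (-(n - k)) t • F t) ∂(haarAddCircle (T := T)) := by
      refine integral_congr_ae (.of_forall fun t => ?_)
      simp only [smul_eq_mul, Finset.sum_mul, Finset.mul_sum]
      refine Finset.sum_congr rfl fun k _ => ?_
      rw [show -(n - k) = -n + k by ring, fourier_add]
      ring
    _ = _ := by
      rw [integral_finsetSum _ fun k _ => hint k]
      simp only [integral_const_mul]

open MeasureTheory AddCircle in
/-- A bound on the symbol of a finite convolution operator bounds its `ℓ²` operator norm. -/
theorem l2norm_finite_conv_le (S : Finset ℤ) (c : ℤ → ℂ) {M : ℝ}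
    (hM : ∀ ξ : ℝ, ‖∑ k ∈ S, c k * Complex.exp (-Complex.I * k * ξ)‖ ≤ M)
    {f : ℤ → ℂ} (hf : Memℓp f 2) :
    Summable (fun m => ‖∑ k ∈ S, c k * f (m - k)‖ ^ 2) ∧
      l2norm (fun m => ∑ k ∈ S, c k * f (m - k)) ≤ M * l2norm f := by
  have hM0 : 0 ≤ M := (norm_nonneg _).trans (hM 0)
  let P : UnitAddCircle → ℂ := fun x => ∑ k ∈ S, c k * fourier k x
  have hP (x : UnitAddCircle) : ‖P x‖ ≤ M := by
    induction x using QuotientAddGroup.induction_on with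
    | H x =>
      refine le_of_eq_of_le ?_ (hM (-(2 * Real.pi * x)))
      congr 1
      refine Finset.sum_congr rfl fun k _ => ?_
      rw [fourier_coe_apply]
      congr 2
      push_cast
      ring
  have hPc : Continuous P := by fun_prop
  let F : Lp ℂ 2 (haarAddCircle (T := 1)) := fourierBasis.repr.symm ⟨f, hf⟩
  have hF (n : ℤ) : fourierCoeff F n = f n := by
    rw [← fourierBasis_repr]
    simp [F]
  have hG : MemLp (fun x => P x * F x) 2 (haarAddCircle (T := 1)) :=
    (Lp.memLp F).of_le_mul (c := M)
      (hPc.aestronglyMeasurable.mul (Lp.memLp F).aestronglyMeasurable)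
      (.of_forall fun x => by rw [norm_mul]; gcongr; exact hP x)
  have hGc (n : ℤ) : fourierCoeff hG.toLp n = ∑ k ∈ S, c k * f (n - k) := by
    rw [fourierCoeff_congr_ae hG.coeFn_toLp,
      fourierCoeff_trigPolynomial_mul S c ((Lp.memLp F).integrable (by norm_num))]
    simp only [hF]
  have hsF := hasSum_sq_fourierCoeff F
  have hsG := hasSum_sq_fourierCoeff hG.toLp
  simp only [hF] at hsF
  simp only [hGc] at hsG
  refine ⟨hsG.summable, ?_⟩
  rw [l2norm, l2norm, hsF.tsum_eq, hsG.tsum_eq]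
  refine Real.sqrt_le_iff.2 ⟨by positivity, ?_⟩
  rw [mul_pow, Real.sq_sqrt (by positivity), ← integral_const_mul]
  refine integral_mono_of_nonneg (.of_forall fun x => by positivity)
    ((Lp.memLp F).integrable_norm_pow (by norm_num) |>.const_mul _) ?_
  filter_upwards [hG.coeFn_toLp] with x hx
  simp only [hx, norm_mul, mul_pow]
  gcongr
  exact hP x

/-- The `ℓ²` operator norm of a finite convolution operator bounds its symbol. -/
theorem norm_symbol_le_of_l2norm_le (S : Finset ℤ) (c : ℤ → ℂ) {K : ℕ}
    (hS : ∀ k ∈ S, |k| ≤ K) {C : ℝ} (hC0 : 0 ≤ C)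
    (hsum : ∀ f : ℤ → ℂ, Memℓp f 2 → Summable fun m => ‖∑ k ∈ S, c k * f (m - k)‖ ^ 2)
    (hC : ∀ f : ℤ → ℂ, Memℓp f 2 →
      l2norm (fun m => ∑ k ∈ S, c k * f (m - k)) ≤ C * l2norm f) (ξ : ℝ) :
    ‖∑ k ∈ S, c k * Complex.exp (-Complex.I * k * ξ)‖ ≤ C := by
  set p := ∑ k ∈ S, c k * Complex.exp (-Complex.I * k * ξ) with hp
  have hexp (m : ℤ) : ‖Complex.exp (Complex.I * m * ξ)‖ = 1 := by
    rw [show Complex.I * m * ξ = ((m * ξ : ℝ) : ℂ) * Complex.I by push_cast; ring,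
      Complex.norm_exp_ofReal_mul_I]
  have key (N : ℕ) : ‖p‖ ^ 2 * N ≤ C ^ 2 * (N + 2 * K + 1) := by
    let J : Finset ℤ := Finset.Icc 0 (N + 2 * K)
    let f : ℤ → ℂ := fun m => if m ∈ J then Complex.exp (Complex.I * m * ξ) else 0
    have hf : Memℓp f 2 := by
      refine memℓp_gen (summable_of_ne_finset_zero (s := J) fun m hm => ?_)
      simp [f, hm]
    have hnf : ∑' m, ‖f m‖ ^ 2 = N + 2 * K + 1 := by
      rw [tsum_eq_sum (s := J) fun m hm => by simp [f, hm],
        Finset.sum_congr rfl (g := fun _ => (1 : ℝ)) fun m hm => by simp [f, hm, hexp]]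
      have : ((N : ℤ) + 2 * K + 1 - 0).toNat = N + 2 * K + 1 := by omega
      simp only [Finset.sum_const, J, Int.card_Icc, this]
      simp
    have hTf : ‖p‖ ^ 2 * N ≤ ∑' m, ‖∑ k ∈ S, c k * f (m - k)‖ ^ 2 := by
      refine le_trans (le_of_eq ?_) ((hsum f hf).sum_le_tsum (Finset.Ico (K : ℤ) (K + N))
        fun _ _ => by positivity)
      rw [Finset.sum_congr rfl (g := fun _ => ‖p‖ ^ 2)]
      · simp [mul_comm]
      · intro m hm
        have : ∑ k ∈ S, c k * f (m - k) = Complex.exp (Complex.I * m * ξ) * p := by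
          rw [hp, Finset.mul_sum]
          refine Finset.sum_congr rfl fun k hk => ?_
          have hmk : m - k ∈ J := by
            have := abs_le.1 (hS k hk)
            simp only [Finset.mem_Ico, Finset.mem_Icc, J] at hm ⊢
            omega
          simp only [f, hmk, if_true]
          rw [mul_left_comm, ← Complex.exp_add]
          congr 2
          push_cast
          ring
        rw [this, norm_mul, hexp, one_mul]
    have h := hC f hf
    rw [l2norm, l2norm, hnf, Real.sqrt_le_left (by positivity), mul_pow,
      Real.sq_sqrt (by positivity)] at h
    exact hTf.trans h
  by_contra! hlt
  have hpos : 0 < ‖p‖ ^ 2 - C ^ 2 := by nlinarith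
  obtain ⟨N, hN⟩ := exists_nat_gt (C ^ 2 * (2 * K + 1) / (‖p‖ ^ 2 - C ^ 2))
  rw [div_lt_iff₀ hpos] at hN
  linarith [key N]

/-- Summation by parts for a kernel supported in `[-K, K]`. -/
theorem tsum_mul_shift_sub_tsum_mul {u : ℤ → ℝ} {K : ℕ} (hK : ∀ k, u k ≠ 0 → |k| ≤ K)
    (g : ℤ → ℂ) :
    ∑' k, (u k : ℂ) * g (k - 1) - ∑' k, (u k : ℂ) * g k
      = ∑ k ∈ Finset.Icc (-(K + 1 : ℤ)) (K + 1), ((u (k + 1) : ℂ) - u k) * g k := by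
  have hu0 (k : ℤ) (hk : K < |k|) : u k = 0 := by
    by_contra h
    exact absurd (hK k h) hk.not_ge
  have h1 (k : ℤ) (hk : k ∉ Finset.Icc (-(K + 1 : ℤ)) (K + 1)) : (u (k + 1) : ℂ) * g k = 0 := by
    rw [hu0 (k + 1) (by rw [Finset.mem_Icc] at hk; rw [lt_abs]; omega)]
    simp
  have h0 (k : ℤ) (hk : k ∉ Finset.Icc (-(K + 1 : ℤ)) (K + 1)) : (u k : ℂ) * g k = 0 := by
    rw [hu0 k (by rw [Finset.mem_Icc] at hk; rw [lt_abs]; omega)]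
    simp
  rw [← (Equiv.addRight (1 : ℤ)).tsum_eq (fun k => (u k : ℂ) * g (k - 1))]
  simp only [Equiv.coe_addRight, add_sub_cancel_right]
  rw [tsum_eq_sum h1, tsum_eq_sum h0, ← Finset.sum_sub_distrib]
  simp only [sub_mul]

theorem l2norm_pos {f : ℤ → ℂ} (hf : Memℓp f 2) (h0 : f ≠ 0) : 0 < l2norm f := by
  obtain ⟨k, hk⟩ := Function.ne_iff.1 h0
  have hs : Summable fun m => ‖f m‖ ^ 2 := by
    simpa using hf.summable (by norm_num)
  have hk' : f k ≠ 0 := hk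
  exact Real.sqrt_pos.2 (hs.tsum_pos (fun _ => by positivity) k (by positivity))

theorem first_derivative_operator_norm_fourier
    (u : ℤ → ℝ) (hu : (Function.support u).Finite) :
    sSup {r : ℝ | ∃ f : ℤ → ℂ, Memℓp f 2 ∧ f ≠ 0 ∧
        r = l2norm (dgrad (conv u f)) / l2norm f} =
      sSup {r : ℝ | ∃ ξ : ℝ,
        r = ‖Complex.exp (Complex.I * (ξ : ℂ)) - 1‖ *
            ‖∑' k : ℤ, (u k : ℂ) * Complex.exp (-(Complex.I) * (k : ℂ) * (ξ : ℂ))‖} := by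
  obtain ⟨K, hK⟩ : ∃ K : ℕ, ∀ k, u k ≠ 0 → |k| ≤ K := by
    obtain ⟨B, hB⟩ := (hu.image fun k : ℤ => k.natAbs).bddAbove
    refine ⟨B, fun k hk => ?_⟩
    have : k.natAbs ≤ B := hB (Set.mem_image_of_mem _ (Function.mem_support.2 hk))
    rw [Int.abs_eq_natAbs]
    exact_mod_cast this
  set S := Finset.Icc (-(K + 1 : ℤ)) (K + 1) with hS
  set c : ℤ → ℂ := fun k => (u (k + 1) : ℂ) - u k with hc
  have hconv (f : ℤ → ℂ) : dgrad (conv u f) = fun m => ∑ k ∈ S, c k * f (m - k) := by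
    funext m
    rw [hS, hc, ← tsum_mul_shift_sub_tsum_mul hK fun k => f (m - k)]
    simp only [dgrad, conv]
    congr! 5
    ring
  have hsymb (ξ : ℝ) : ‖Complex.exp (Complex.I * (ξ : ℂ)) - 1‖ *
      ‖∑' k : ℤ, (u k : ℂ) * Complex.exp (-(Complex.I) * (k : ℂ) * (ξ : ℂ))‖
        = ‖∑ k ∈ S, c k * Complex.exp (-Complex.I * k * ξ)‖ := by
    rw [hS, hc, ← tsum_mul_shift_sub_tsum_mul hK fun k => Complex.exp (-Complex.I * k * ξ),
      ← norm_mul, sub_mul, one_mul, ← tsum_mul_left]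
    congr! 4 with k
    rw [mul_left_comm, ← Complex.exp_add]
    congr 2
    push_cast
    ring
  simp only [hconv, hsymb]
  set A := {r : ℝ | ∃ f : ℤ → ℂ, Memℓp f 2 ∧ f ≠ 0 ∧
    r = l2norm (fun m => ∑ k ∈ S, c k * f (m - k)) / l2norm f}
  set B := {r : ℝ | ∃ ξ : ℝ, r = ‖∑ k ∈ S, c k * Complex.exp (-Complex.I * k * ξ)‖}
  have hBbdd : BddAbove B := by
    refine ⟨∑ k ∈ S, ‖c k‖, ?_⟩
    rintro _ ⟨ξ, rfl⟩
    refine (norm_sum_le _ _).trans (Finset.sum_le_sum fun k _ => ?_)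
    rw [norm_mul, show -Complex.I * k * ξ = ((-(k * ξ) : ℝ) : ℂ) * Complex.I by push_cast; ring,
      Complex.norm_exp_ofReal_mul_I, mul_one]
  have hle (ξ : ℝ) : ‖∑ k ∈ S, c k * Complex.exp (-Complex.I * k * ξ)‖ ≤ sSup B :=
    le_csSup hBbdd ⟨ξ, rfl⟩
  have hup : ∀ r ∈ A, r ≤ sSup B := by
    rintro _ ⟨f, hf, h0, rfl⟩
    exact (div_le_iff₀ (l2norm_pos hf h0)).2 (l2norm_finite_conv_le S c hle hf).2
  have hA0 : ∀ r ∈ A, 0 ≤ r := by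
    rintro _ ⟨f, -, -, rfl⟩
    exact div_nonneg (Real.sqrt_nonneg _) (Real.sqrt_nonneg _)
  refine le_antisymm (Real.sSup_le hup ((norm_nonneg _).trans (hle 0))) ?_
  refine Real.sSup_le ?_ (Real.sSup_nonneg hA0)
  rintro _ ⟨ξ, rfl⟩
  refine norm_symbol_le_of_l2norm_le S c (K := K + 1) (fun k hk => ?_) (Real.sSup_nonneg hA0)
    (fun f hf => (l2norm_finite_conv_le S c hle hf).1) (fun f hf => ?_) ξ
  · rw [hS, Finset.mem_Icc] at hk
    rw [abs_le]
    push_cast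
    exact hk
  · by_cases h0 : f = 0
    · simp [h0, l2norm]
    · exact (div_le_iff₀ (l2norm_pos hf h0)).1 (le_csSup ⟨_, hup⟩ ⟨f, hf, h0, rfl⟩)
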